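/- Any optimal transport plan π̂ ∈ M^+(X) of the primal problem UMOT_ε(μ) and any tuple f̂ ∈ L^{∞,×}(X) of optimal dual potentials (maximizing the dual UMOT functional) are related by π̂ = exp((f̂^⊕ − c)/ε) γ^⊗, i.e., π̂ is absolutely continuous with respect to γ^⊗ with density exp((f̂^⊕ − c)/ε). -/

import Mathlib

open MeasureTheory ENNReal Real Filter Topology

noncomputable section
namespace UMOT

/-- The Boltzmann–Shannon entropy integrand `x ↦ x log x − x + 1` (with value `⊤` on `(-∞,0)`). -/
def klFun (x : ℝ) : ℝ≥0∞ := if x < 0 then ⊤ else ENNReal.ofReal (x * Real.log x - x + 1)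

/-- The recession constant `φ'_∞ = lim_{x→∞} φ(x)/x` of an entropy function. -/
def recession (φ : ℝ → ℝ≥0∞) : ℝ≥0∞ :=
  Filter.limsup (fun x : ℝ => φ x / ENNReal.ofReal x) Filter.atTop

/-- The φ-divergence `D_φ(μ,ν) = ∫ φ(dμ/dν) dν + φ'_∞ μ^⊥(X)`. -/
def Dphi {Z : Type*} [MeasurableSpace Z] (φ : ℝ → ℝ≥0∞) (μ ν : Measure Z) : ℝ≥0∞ :=
  ∫⁻ z, φ ((μ.rnDeriv ν z).toReal) ∂ν + recession φ * μ.singularPart ν Set.univ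

/-- The Kullback–Leibler divergence, i.e. the φ-divergence for the Boltzmann–Shannon entropy. -/
def KL {Z : Type*} [MeasurableSpace Z] (μ ν : Measure Z) : ℝ≥0∞ := Dphi klFun μ ν

/-- An entropy function: nonnegative (by the codomain `ℝ≥0∞`), proper (since `φ 1 = 0`),
convex, lower semicontinuous, with `φ 1 = 0` and `φ = ⊤` on `(-∞,0)`. -/
structure IsEntropyFunction (φ : ℝ → ℝ≥0∞) : Prop where
  one_eq_zero : φ 1 = 0
  top_of_neg : ∀ x : ℝ, x < 0 → φ x = ⊤
  lsc : LowerSemicontinuous φ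
  convex : ∀ x y t : ℝ, 0 ≤ t → t ≤ 1 →
    φ (t * x + (1 - t) * y) ≤ ENNReal.ofReal t * φ x + ENNReal.ofReal (1 - t) * φ y

/-- The primal UMOT cost of a transport plan `pl`. -/
def primalCost {N : ℕ} {X : Fin N → Type*} [∀ i, MeasurableSpace (X i)]
    (c : (∀ i, X i) → ℝ) (ε : ℝ) (φ : Fin N → ℝ → ℝ≥0∞)
    (μ γ : ∀ i, Measure (X i)) (pl : Measure (∀ i, X i)) : ℝ≥0∞ :=
  ∫⁻ x, ENNReal.ofReal (c x) ∂pl + ENNReal.ofReal ε * KL pl (Measure.pi γ)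
    + ∑ i, Dphi (φ i) (pl.map fun x => x i) (μ i)

/-- The UMOT value: infimum of the primal cost over all finite measures. -/
def UMOTval {N : ℕ} {X : Fin N → Type*} [∀ i, MeasurableSpace (X i)]
    (c : (∀ i, X i) → ℝ) (ε : ℝ) (φ : Fin N → ℝ → ℝ≥0∞)
    (μ γ : ∀ i, Measure (X i)) : ℝ≥0∞ :=
  ⨅ (pl : Measure (∀ i, X i)) (_ : IsFiniteMeasure pl), primalCost c ε φ μ γ pl

/-- Fenchel conjugate `φ^*(q) = sup_x (qx − φ(x))`, valued in the extended reals. -/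
def fconj (φ : ℝ → ℝ≥0∞) (q : ℝ) : EReal :=
  ⨆ x : ℝ, ((q * x : ℝ) : EReal) - ((φ x : ℝ≥0∞) : EReal)

/-- The nonnegative part of an extended real number, as an element of `ℝ≥0∞`. -/
def erealToENNReal (x : EReal) : ℝ≥0∞ := if x = ⊤ then ⊤ else ENNReal.ofReal x.toReal

/-- Integral of an extended-real-valued function (difference of the integrals of the
positive and negative parts). -/
def eInt {Z : Type*} [MeasurableSpace Z] (μ : Measure Z) (g : Z → EReal) : EReal :=
  ((∫⁻ z, erealToENNReal (g z) ∂μ : ℝ≥0∞) : EReal)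
    - ((∫⁻ z, erealToENNReal (-(g z)) ∂μ : ℝ≥0∞) : EReal)

/-- `f^⊕(x) = Σ_i f_i(x_i)`. -/
def fOplus {N : ℕ} {X : Fin N → Type*} (f : ∀ i, X i → ℝ) (x : ∀ i, X i) : ℝ :=
  ∑ i, f i (x i)

/-- Membership in `L^{∞,×}(X)`: each component is a bounded measurable function. -/
def BddMeasTuple {N : ℕ} {X : Fin N → Type*} [∀ i, MeasurableSpace (X i)]
    (f : ∀ i, X i → ℝ) : Prop :=
  ∀ i, Measurable (f i) ∧ ∃ M : ℝ, ∀ x, |f i x| ≤ M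

/-- The dual UMOT functional
`f ↦ −Σ_i ∫ φ_i^*(−f_i) dμ_i − ε ∫ (exp((f^⊕ − c)/ε) − 1) dγ^⊗`. -/
def dualFun {N : ℕ} {X : Fin N → Type*} [∀ i, MeasurableSpace (X i)]
    (c : (∀ i, X i) → ℝ) (ε : ℝ) (φ : Fin N → ℝ → ℝ≥0∞)
    (μ γ : ∀ i, Measure (X i)) (f : ∀ i, X i → ℝ) : EReal :=
  - (∑ i, eInt (μ i) (fun y => fconj (φ i) (-(f i y))))
    - (ε : EReal) * (((∫⁻ x, ENNReal.ofReal (Real.exp ((fOplus f x - c x) / ε))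
          ∂(Measure.pi γ) : ℝ≥0∞) : EReal) - ((Measure.pi γ Set.univ : ℝ≥0∞) : EReal))

section Conjugate

variable {φ : ℝ → ℝ≥0∞}

lemma fconj_le_coe_iff (q a : ℝ) :
    fconj φ q ≤ (a : EReal) ↔ ∀ x, φ x ≠ ⊤ → q * x - (φ x).toReal ≤ a := by
  rw [fconj, iSup_le_iff]
  refine forall_congr' fun x => ?_
  by_cases hx : φ x = ⊤
  · simp [hx]
  · lift φ x to NNReal using hx with r
    simp only [ne_eq, coe_ne_top, not_false_eq_true, coe_toReal, forall_const]
    rw [EReal.coe_nnreal_eq_coe_real, ← EReal.coe_sub, EReal.coe_le_coe_iff]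

lemma IsEntropyFunction.le_fconj (hφ : IsEntropyFunction φ) (q : ℝ) : (q : EReal) ≤ fconj φ q := by
  refine le_iSup_of_le 1 ?_
  simp [hφ.one_eq_zero]

lemma IsEntropyFunction.fconj_ne_bot (hφ : IsEntropyFunction φ) (q : ℝ) : fconj φ q ≠ ⊥ :=
  ne_bot_of_le_ne_bot (EReal.coe_ne_bot q) (hφ.le_fconj q)

lemma IsEntropyFunction.coe_toReal_fconj (hφ : IsEntropyFunction φ) {q : ℝ}
    (hq : fconj φ q ≠ ⊤) : ((fconj φ q).toReal : EReal) = fconj φ q :=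
  EReal.coe_toReal hq (hφ.fconj_ne_bot q)

lemma IsEntropyFunction.le_toReal_fconj (hφ : IsEntropyFunction φ) {q : ℝ}
    (hq : fconj φ q ≠ ⊤) : q ≤ (fconj φ q).toReal := by
  have := hφ.le_fconj q
  rwa [← hφ.coe_toReal_fconj hq, EReal.coe_le_coe_iff] at this

lemma IsEntropyFunction.young (hφ : IsEntropyFunction φ) {q x : ℝ}
    (hq : fconj φ q ≠ ⊤) (hx : φ x ≠ ⊤) : q * x - (φ x).toReal ≤ (fconj φ q).toReal :=
  (fconj_le_coe_iff q _).1 (hφ.coe_toReal_fconj hq).ge x hx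

lemma IsEntropyFunction.fconj_mono (hφ : IsEntropyFunction φ) : Monotone (fconj φ) := by
  intro p q hpq
  refine iSup_mono fun x => ?_
  rcases lt_or_ge x 0 with hx | hx
  · simp [hφ.top_of_neg x hx]
  · exact EReal.sub_le_sub (EReal.coe_le_coe_iff.2 (mul_le_mul_of_nonneg_right hpq hx)) le_rfl

lemma IsEntropyFunction.fconj_zero (hφ : IsEntropyFunction φ) : fconj φ 0 = 0 := by
  refine le_antisymm ?_ (by simpa using hφ.le_fconj 0)
  have := (fconj_le_coe_iff (φ := φ) 0 0).2 fun x _ => by simp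
  simpa using this

lemma IsEntropyFunction.isClosed_epigraph (hφ : IsEntropyFunction φ) :
    IsClosed {z : ℝ × ℝ | φ z.1 ≤ ENNReal.ofReal z.2} := by
  have h := (lowerSemicontinuous_iff_isClosed_epigraph (f := φ)).1 hφ.lsc
  exact h.preimage (f := fun z : ℝ × ℝ => (z.1, ENNReal.ofReal z.2))
    (continuous_fst.prodMk (ENNReal.continuous_ofReal.comp continuous_snd))

/-- The epigraph is restricted to nonnegative heights, since `ENNReal.ofReal` truncates. -/
lemma IsEntropyFunction.convex_epigraph (hφ : IsEntropyFunction φ) :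
    Convex ℝ {z : ℝ × ℝ | φ z.1 ≤ ENNReal.ofReal z.2 ∧ 0 ≤ z.2} := by
  rintro ⟨x, r⟩ ⟨hx, hr⟩ ⟨y, s⟩ ⟨hy, hs⟩ a b ha hb hab
  obtain rfl : b = 1 - a := by linarith
  simp only [Prod.smul_mk, Prod.mk_add_mk, smul_eq_mul, Set.mem_ofPred_eq] at *
  refine ⟨(hφ.convex x y a ha (by linarith)).trans ?_, by positivity⟩
  rw [ENNReal.ofReal_add (by positivity) (by positivity), ENNReal.ofReal_mul ha,
    ENNReal.ofReal_mul hb]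
  gcongr

/-- Every real number below `φ s` is the value at `s` of an affine minorant of `φ`. -/
lemma IsEntropyFunction.exists_fconj_le (hφ : IsEntropyFunction φ) {s a : ℝ}
    (has : ENNReal.ofReal a < φ s) :
    ∃ p : ℝ, fconj φ p ≤ ((p * s - a : ℝ) : EReal) := by
  obtain ⟨f, u, hfu, hf⟩ := geometric_hahn_banach_point_closed hφ.convex_epigraph
    (hφ.isClosed_epigraph.inter (isClosed_Ici.preimage continuous_snd)) (x := (s, a))
    (by simp [has])
  have hlin : ∀ x r, f (x, r) = f (1, 0) * x + f (0, 1) * r := fun x r => by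
    have : ((x, r) : ℝ × ℝ) = x • (1, 0) + r • (0, 1) := by simp
    rw [this, map_add, map_smul, map_smul, smul_eq_mul, smul_eq_mul]; ring
  generalize f (1, 0) = α at hlin
  generalize f (0, 1) = β at hlin
  rw [hlin] at hfu
  have hf' : ∀ x r, φ x ≠ ⊤ → (φ x).toReal ≤ r → u < α * x + β * r := fun x r hx hr => by
    rw [← hlin]
    exact hf _ ⟨(ENNReal.le_ofReal_iff_toReal_le hx (toReal_nonneg.trans hr)).2 hr,
      toReal_nonneg.trans hr⟩
  have hβ : 0 ≤ β := by
    by_contra! hneg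
    have h1 := hf' 1 (max 0 ((u - α) / β)) (by simp [hφ.one_eq_zero]) (by simp [hφ.one_eq_zero])
    have h2 : β * max 0 ((u - α) / β) ≤ β * ((u - α) / β) :=
      mul_le_mul_of_nonpos_left (le_max_right _ _) hneg.le
    rw [mul_div_cancel₀ _ hneg.ne] at h2
    linarith
  rcases hβ.eq_or_lt with rfl | hβ
  · obtain ⟨n, hn⟩ := exists_nat_gt (a / (u - α * s))
    have hpos : 0 < u - α * s := by linarith
    rw [div_lt_iff₀ hpos] at hn
    refine ⟨-(n * α), (fconj_le_coe_iff _ _).2 fun x hx => ?_⟩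
    have h1 := hf' x _ hx le_rfl
    have h2 : (0 : ℝ) ≤ (φ x).toReal := toReal_nonneg
    have h3 : (n : ℝ) * (u - α * s) ≤ n * (α * x - α * s) := by gcongr; linarith
    nlinarith
  · refine ⟨-(α / β), (fconj_le_coe_iff _ _).2 fun x hx => ?_⟩
    have h1 := hf' x _ hx le_rfl
    have h2 : α * s + β * a < α * x + β * (φ x).toReal := by linarith
    have h3 : (α * s + β * a) / β ≤ (α * x + β * (φ x).toReal) / β := by gcongr
    have e1 : (α * s + β * a) / β = α / β * s + a := by field_simp
    have e2 : (α * x + β * (φ x).toReal) / β = α / β * x + (φ x).toReal := by field_simp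
    linarith

lemma fconj_convex_le {p q a b t : ℝ} (ht : 0 ≤ t) (ht1 : t ≤ 1)
    (hp : fconj φ p ≤ (a : EReal)) (hq : fconj φ q ≤ (b : EReal)) :
    fconj φ ((1 - t) * p + t * q) ≤ (((1 - t) * a + t * b : ℝ) : EReal) := by
  rw [fconj_le_coe_iff] at *
  intro x hx
  have h1 := mul_le_mul_of_nonneg_left (hp x hx) (sub_nonneg.2 ht1)
  have h2 := mul_le_mul_of_nonneg_left (hq x hx) ht
  linarith

lemma tendsto_mul_exp_div_sub_one (k : ℝ) :
    Tendsto (fun n : ℕ => (n : ℝ) * (Real.exp (k / n) - 1)) atTop (𝓝 k) := by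
  have h : HasDerivAt (fun x => Real.exp (k * x)) k 0 := by
    simpa using ((hasDerivAt_id (0 : ℝ)).const_mul k).exp
  have h2 := h.tendsto_slope_zero_right.comp tendsto_inv_atTop_nhdsGT_zero
  refine (h2.comp tendsto_natCast_atTop_atTop).congr fun n => ?_
  simp [div_eq_mul_inv]

/-- If `h ↦ φ^*(q - h) + ε s exp (h / ε)` is minimal at `0` among rational `h`, then `s` is a
subgradient of `φ^*` at `q`. -/
lemma IsEntropyFunction.le_sub_of_rational_minimizer (hφ : IsEntropyFunction φ) {q s ε : ℝ}
    (hε : 0 < ε) (hs : 0 ≤ s) (hq : fconj φ q ≠ ⊤)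
    (hmin : ∀ h : ℚ, fconj φ (q - h) ≠ ⊤ →
      (fconj φ q).toReal ≤ (fconj φ (q - h)).toReal + ε * (Real.exp (h / ε) - 1) * s)
    {p a : ℝ} (hp : fconj φ p ≤ ((p * s - a : ℝ) : EReal)) :
    a ≤ q * s - (fconj φ q).toReal := by
  have key : ∀ h : ℚ, q - p < h → (fconj φ q).toReal ≤ p * s - a + h * s := by
    intro h hh
    have hle : fconj φ (q - h) ≤ ((p * s - a : ℝ) : EReal) :=
      (hφ.fconj_mono (by linarith)).trans hp
    have hlim : Tendsto (fun n : ℕ => (p * s - a) +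
        ε * ((n : ℝ) * (Real.exp ((h / ε) / n) - 1)) * s) atTop
        (𝓝 ((p * s - a) + ε * (h / ε) * s)) :=
      (((tendsto_mul_exp_div_sub_one (h / ε)).const_mul ε).mul_const s).const_add _
    rw [mul_div_cancel₀ _ hε.ne'] at hlim
    refine ge_of_tendsto hlim ?_
    filter_upwards [eventually_ge_atTop 1] with n hn
    have hn0 : (0 : ℝ) < n := by exact_mod_cast hn
    have hn1 : (n : ℝ)⁻¹ ≤ 1 := inv_le_one_of_one_le₀ (by exact_mod_cast hn)
    have hc := fconj_convex_le (φ := φ) (inv_nonneg.2 hn0.le) hn1 (hφ.coe_toReal_fconj hq).ge hle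
    have he : (1 - (n : ℝ)⁻¹) * q + (n : ℝ)⁻¹ * (q - h) = q - ((h / n : ℚ) : ℝ) := by
      push_cast; field_simp; ring
    rw [he] at hc
    have hfin : fconj φ (q - ((h / n : ℚ) : ℝ)) ≠ ⊤ := ne_top_of_le_ne_top (EReal.coe_ne_top _) hc
    have hm := hmin (h / n) hfin
    rw [← hφ.coe_toReal_fconj hfin, EReal.coe_le_coe_iff] at hc
    have he2 : (((h / n : ℚ) : ℝ)) / ε = (h / ε) / n := by push_cast; field_simp
    rw [he2] at hm
    have h3 : (n : ℝ)⁻¹ * (fconj φ q).toReal ≤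
        (n : ℝ)⁻¹ * (p * s - a) + ε * (Real.exp ((h / ε) / n) - 1) * s := by linarith
    have h4 := mul_le_mul_of_nonneg_left h3 hn0.le
    have h5 : (n : ℝ) * ((n : ℝ)⁻¹ * (fconj φ q).toReal) = (fconj φ q).toReal := by field_simp
    have h6 : (n : ℝ) * ((n : ℝ)⁻¹ * (p * s - a) + ε * (Real.exp ((h / ε) / n) - 1) * s) =
        (p * s - a) + ε * (n * (Real.exp ((h / ε) / n) - 1)) * s := by field_simp
    linarith
  have : (fconj φ q).toReal ≤ p * s - a + (q - p) * s := by
    refine le_of_forall_pos_le_add fun δ hδ => ?_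
    obtain ⟨h, h1, h2⟩ := exists_rat_btwn (show q - p < q - p + δ / (s + 1) by
      have : 0 < δ / (s + 1) := by positivity
      linarith)
    have h3 := key h h1
    have h4 : (h : ℝ) * s ≤ (q - p + δ / (s + 1)) * s := by gcongr
    have h5 : δ / (s + 1) * s ≤ δ := by
      rw [div_mul_eq_mul_div, div_le_iff₀ (by positivity)]; nlinarith
    linarith
  linarith

/-- Equality in the Fenchel–Young inequality at a rational minimizer. -/
lemma IsEntropyFunction.toReal_le_of_rational_minimizer (hφ : IsEntropyFunction φ) {q s ε : ℝ}
    (hε : 0 < ε) (hs : 0 ≤ s) (hq : fconj φ q ≠ ⊤)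
    (hmin : ∀ h : ℚ, fconj φ (q - h) ≠ ⊤ →
      (fconj φ q).toReal ≤ (fconj φ (q - h)).toReal + ε * (Real.exp (h / ε) - 1) * s) :
    φ s ≠ ⊤ ∧ (φ s).toReal ≤ q * s - (fconj φ q).toReal := by
  have hnn : 0 ≤ q * s - (fconj φ q).toReal :=
    hφ.le_sub_of_rational_minimizer hε hs hq hmin (p := 0) (by simp [hφ.fconj_zero])
  have hle : φ s ≤ ENNReal.ofReal (q * s - (fconj φ q).toReal) := by
    refine le_of_forall_lt fun b hb => ?_
    obtain ⟨a, hba, ha⟩ := exists_between hb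
    refine hba.trans_le ?_
    lift a to NNReal using ha.ne_top
    rw [← ENNReal.ofReal_coe_nnreal] at ha ⊢
    obtain ⟨p, hp⟩ := hφ.exists_fconj_le ha
    exact ENNReal.ofReal_le_ofReal (hφ.le_sub_of_rational_minimizer hε hs hq hmin hp)
  exact ⟨ne_top_of_le_ne_top ofReal_ne_top hle, toReal_le_of_le_ofReal hnn hle⟩

end Conjugate

section ExtendedIntegral

variable {Z : Type*} [MeasurableSpace Z] {m : Measure Z}

lemma erealToENNReal_coe (x : ℝ) : erealToENNReal x = ENNReal.ofReal x := by
  simp [erealToENNReal]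

lemma eInt_eq_integral {g : Z → EReal} {r : Z → ℝ} (h : ∀ᵐ z ∂m, g z = r z)
    (hr : Integrable r m) : eInt m g = ((∫ z, r z ∂m : ℝ) : EReal) := by
  have h1 : ∫⁻ z, erealToENNReal (g z) ∂m = ∫⁻ z, ENNReal.ofReal (r z) ∂m :=
    lintegral_congr_ae (h.mono fun z hz => by simp only [hz, erealToENNReal_coe])
  have h2 : ∫⁻ z, erealToENNReal (-(g z)) ∂m = ∫⁻ z, ENNReal.ofReal (-(r z)) ∂m :=
    lintegral_congr_ae (h.mono fun z hz => by
      simp only [hz, ← EReal.coe_neg, erealToENNReal_coe])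
  have f1 : ∫⁻ z, ENNReal.ofReal (r z) ∂m ≠ ⊤ := hr.lintegral_lt_top.ne
  have f2 : ∫⁻ z, ENNReal.ofReal (-(r z)) ∂m ≠ ⊤ := hr.neg.lintegral_lt_top.ne
  rw [eInt, h1, h2, integral_eq_lintegral_pos_part_sub_lintegral_neg_part hr, EReal.coe_sub,
    EReal.coe_ennreal_toReal f1, EReal.coe_ennreal_toReal f2]

variable {φ : ℝ → ℝ≥0∞} {f : Z → ℝ}

lemma IsEntropyFunction.measurable_fconj_comp (hφ : IsEntropyFunction φ) (hf : Measurable f) :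
    Measurable fun z => fconj φ (-(f z)) :=
  hφ.fconj_mono.measurable.comp hf.neg

lemma IsEntropyFunction.lintegral_neg_fconj_ne_top [IsFiniteMeasure m]
    (hφ : IsEntropyFunction φ) {M : ℝ} (hM : ∀ z, |f z| ≤ M) :
    ∫⁻ z, erealToENNReal (-(fconj φ (-(f z)))) ∂m ≠ ⊤ := by
  refine ne_top_of_le_ne_top (b := ∫⁻ _, ENNReal.ofReal M ∂m)
    (by simp [ENNReal.mul_eq_top]) (lintegral_mono fun z => ?_)
  by_cases h : fconj φ (-(f z)) = ⊤
  · simp [h, erealToENNReal]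
  · dsimp only
    rw [← hφ.coe_toReal_fconj h, ← EReal.coe_neg, erealToENNReal_coe]
    refine ENNReal.ofReal_le_ofReal ?_
    have := hφ.le_toReal_fconj h
    linarith [le_abs_self (f z), hM z]

lemma IsEntropyFunction.eInt_fconj_ne_bot [IsFiniteMeasure m]
    (hφ : IsEntropyFunction φ) {M : ℝ} (hM : ∀ z, |f z| ≤ M) :
    eInt m (fun z => fconj φ (-(f z))) ≠ ⊥ := by
  rw [eInt, ← EReal.coe_ennreal_toReal (hφ.lintegral_neg_fconj_ne_top hM),
    sub_eq_add_neg, ← EReal.coe_neg]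
  simp [EReal.add_eq_bot_iff]

lemma IsEntropyFunction.ae_fconj_ne_top [IsFiniteMeasure m]
    (hφ : IsEntropyFunction φ) (hf : Measurable f) {M : ℝ} (hM : ∀ z, |f z| ≤ M)
    (h : eInt m (fun z => fconj φ (-(f z))) ≠ ⊤) :
    (∀ᵐ z ∂m, fconj φ (-(f z)) ≠ ⊤) ∧
      Integrable (fun z => (fconj φ (-(f z))).toReal) m := by
  have hmeas := hφ.measurable_fconj_comp hf
  have hpos : ∫⁻ z, erealToENNReal (fconj φ (-(f z))) ∂m ≠ ⊤ := by
    intro hp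
    apply h
    rw [eInt, hp, ← EReal.coe_ennreal_toReal (hφ.lintegral_neg_fconj_ne_top hM)]
    simp
  have hmE : Measurable fun z => erealToENNReal (fconj φ (-(f z))) :=
    Measurable.ite (hmeas (measurableSet_singleton ⊤)) measurable_const
      hmeas.ereal_toReal.ennreal_ofReal
  have hfin : ∀ᵐ z ∂m, fconj φ (-(f z)) ≠ ⊤ := by
    filter_upwards [ae_lt_top hmE hpos] with z hz htop
    simp [htop, erealToENNReal] at hz
  refine ⟨hfin, hmeas.ereal_toReal.aestronglyMeasurable, ?_⟩
  have hle : ∀ᵐ z ∂m, ‖(fconj φ (-(f z))).toReal‖ₑ ≤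
      erealToENNReal (fconj φ (-(f z))) + erealToENNReal (-(fconj φ (-(f z)))) := by
    filter_upwards [hfin] with z hz
    rw [← hφ.coe_toReal_fconj hz, ← EReal.coe_neg, erealToENNReal_coe, erealToENNReal_coe,
      EReal.toReal_coe, Real.enorm_eq_ofReal_abs]
    rcases le_total 0 (fconj φ (-(f z))).toReal with h0 | h0
    · rw [abs_of_nonneg h0]; exact le_self_add
    · rw [abs_of_nonpos h0]; exact le_add_self
  refine (lintegral_mono_ae hle).trans_lt ?_
  rw [lintegral_add_left hmE]
  exact ENNReal.add_lt_top.2 ⟨hpos.lt_top, (hφ.lintegral_neg_fconj_ne_top hM).lt_top⟩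

end ExtendedIntegral

section Dual

lemma coe_finset_sum {ι : Type*} (s : Finset ι) (g : ι → ℝ) :
    ((∑ i ∈ s, g i : ℝ) : EReal) = ∑ i ∈ s, (g i : EReal) := by
  induction s using Finset.cons_induction with
  | empty => simp
  | cons a s ha ih => simp only [Finset.sum_cons, EReal.coe_add, ih]

lemma sum_ereal_ne_bot {ι : Type*} (s : Finset ι) (g : ι → EReal) (h : ∀ i ∈ s, g i ≠ ⊥) :
    ∑ i ∈ s, g i ≠ ⊥ := by
  induction s using Finset.cons_induction with
  | empty => simp
  | cons a s ha ih =>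
    rw [Finset.sum_cons, Ne, EReal.add_eq_bot_iff, not_or]
    exact ⟨h a (by simp), ih fun i hi => h i (by simp [hi])⟩

lemma fOplus_update {N : ℕ} {X : Fin N → Type*} {f : ∀ i, X i → ℝ} (i : Fin N) (v : X i → ℝ)
    (x : ∀ i, X i) :
    fOplus (Function.update f i v) x = fOplus f x - f i (x i) + v (x i) := by
  have h : (fun j => Function.update f i v j (x j)) =
      Function.update (fun j => f j (x j)) i (v (x i)) := by
    ext j
    exact Function.apply_update (fun j (w : X j → ℝ) => w (x j)) f i v j
  rw [fOplus, h, Finset.sum_update_of_mem (Finset.mem_univ i), fOplus,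
    ← Finset.add_sum_erase _ _ (Finset.mem_univ i), Finset.sdiff_singleton_eq_erase]
  ring

variable {N : ℕ} {X : Fin N → Type*} [∀ i, MeasurableSpace (X i)]
  {μ γ : ∀ i, Measure (X i)} [∀ i, IsFiniteMeasure (γ i)]
  {c : (∀ i, X i) → ℝ} {ε : ℝ} {φ : Fin N → ℝ → ℝ≥0∞} {f : ∀ i, X i → ℝ}

/-- The plan `exp((f^⊕ − c)/ε) γ^⊗`. -/
def gibbs (c : (∀ i, X i) → ℝ) (ε : ℝ) (γ : ∀ i, Measure (X i)) (f : ∀ i, X i → ℝ) :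
    Measure (∀ i, X i) :=
  (Measure.pi γ).withDensity fun x => ENNReal.ofReal (Real.exp ((fOplus f x - c x) / ε))

lemma BddMeasTuple.measurable_fOplus (hf : BddMeasTuple f) : Measurable (fOplus f) :=
  Finset.measurable_sum _ fun i _ => (hf i).1.comp (measurable_pi_apply i)

lemma BddMeasTuple.exists_abs_fOplus_le (hf : BddMeasTuple f) : ∃ M, ∀ x, |fOplus f x| ≤ M := by
  choose M hM using fun i => (hf i).2
  exact ⟨∑ i, M i, fun x => (Finset.abs_sum_le_sum_abs _ _).trans
    (Finset.sum_le_sum fun i _ => hM i (x i))⟩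

lemma BddMeasTuple.exists_exp_le (hε : 0 < ε) (hc0 : ∀ x, 0 ≤ c x) (hf : BddMeasTuple f) :
    ∃ M, ∀ x, Real.exp ((fOplus f x - c x) / ε) ≤ M := by
  obtain ⟨M, hM⟩ := hf.exists_abs_fOplus_le
  refine ⟨Real.exp (M / ε), fun x => Real.exp_le_exp.2 ?_⟩
  gcongr
  linarith [le_abs_self (fOplus f x), hM x, hc0 x]

lemma BddMeasTuple.isFiniteMeasure_gibbs (hε : 0 < ε) (hc0 : ∀ x, 0 ≤ c x)
    (hf : BddMeasTuple f) : IsFiniteMeasure (gibbs c ε γ f) := by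
  obtain ⟨M, hM⟩ := hf.exists_exp_le hε hc0
  refine isFiniteMeasure_withDensity (ne_top_of_le_ne_top
    (b := ∫⁻ _, ENNReal.ofReal M ∂(Measure.pi γ)) (by simp [ENNReal.mul_eq_top])
    (lintegral_mono fun x => ENNReal.ofReal_le_ofReal (hM x)))

lemma dualFun_eq_sub (hε : 0 < ε) (hc0 : ∀ x, 0 ≤ c x) (hf : BddMeasTuple f) :
    dualFun c ε φ μ γ f = - (∑ i, eInt (μ i) (fun y => fconj (φ i) (-(f i y)))) -
      ((ε * ((gibbs c ε γ f).real Set.univ - (Measure.pi γ).real Set.univ) : ℝ) : EReal) := by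
  have := hf.isFiniteMeasure_gibbs (γ := γ) hε hc0
  rw [dualFun, EReal.coe_mul, EReal.coe_sub, Measure.real, Measure.real,
    EReal.coe_ennreal_toReal (measure_ne_top _ _),
    EReal.coe_ennreal_toReal (measure_ne_top _ _), gibbs,
    withDensity_apply _ MeasurableSet.univ, setLIntegral_univ]

lemma dualFun_eq_coe (hε : 0 < ε) (hc0 : ∀ x, 0 ≤ c x) (hφ : ∀ i, IsEntropyFunction (φ i))
    (hf : BddMeasTuple f) (hfin : ∀ i, ∀ᵐ y ∂(μ i), fconj (φ i) (-(f i y)) ≠ ⊤)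
    (hint : ∀ i, Integrable (fun y => (fconj (φ i) (-(f i y))).toReal) (μ i)) :
    dualFun c ε φ μ γ f = ((- (∑ i, ∫ y, (fconj (φ i) (-(f i y))).toReal ∂(μ i)) -
      ε * ((gibbs c ε γ f).real Set.univ - (Measure.pi γ).real Set.univ) : ℝ) : EReal) := by
  rw [dualFun_eq_sub hε hc0 hf, EReal.coe_sub, EReal.coe_neg]
  congr 2
  rw [coe_finset_sum]
  refine Finset.sum_congr rfl fun i _ => eInt_eq_integral ?_ (hint i)
  filter_upwards [hfin i] with y hy using ((hφ i).coe_toReal_fconj hy).symm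

variable [∀ i, IsFiniteMeasure (μ i)]

/-- A maximizer of the dual functional has finite dual value. -/
lemma fconj_finite_of_dual_optimal (hε : 0 < ε) (hc0 : ∀ x, 0 ≤ c x)
    (hφ : ∀ i, IsEntropyFunction (φ i)) (hf : BddMeasTuple f)
    (hopt : ∀ g : ∀ i, X i → ℝ, BddMeasTuple g → dualFun c ε φ μ γ g ≤ dualFun c ε φ μ γ f)
    (i : Fin N) : (∀ᵐ y ∂(μ i), fconj (φ i) (-(f i y)) ≠ ⊤) ∧
      Integrable (fun y => (fconj (φ i) (-(f i y))).toReal) (μ i) := by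
  have h0 : BddMeasTuple (fun i (_ : X i) => (0 : ℝ)) := fun i => ⟨measurable_const, 0, by simp⟩
  have hle := hopt _ h0
  rw [dualFun_eq_coe hε hc0 hφ h0 (by simp [(hφ _).fconj_zero]) (by simp [(hφ _).fconj_zero])]
    at hle
  have hne := ne_bot_of_le_ne_bot (EReal.coe_ne_bot _) hle
  obtain ⟨M, hM⟩ := (hf i).2
  refine (hφ i).ae_fconj_ne_top (hf i).1 hM fun htop => hne ?_
  rw [dualFun_eq_sub hε hc0 hf, ← Finset.add_sum_erase _ _ (Finset.mem_univ i), htop,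
    EReal.top_add_of_ne_bot]
  · simp
  · exact sum_ereal_ne_bot _ _ fun j _ => by
      obtain ⟨M, hM⟩ := (hf j).2
      exact (hφ j).eInt_fconj_ne_bot hM

lemma gibbs_update_indicator_real (hε : 0 < ε) (hc0 : ∀ x, 0 ≤ c x) (hf : BddMeasTuple f)
    (i : Fin N) {A : Set (X i)} (hA : MeasurableSet A) (h : ℝ) :
    (gibbs c ε γ (Function.update f i fun y => f i y + A.indicator (fun _ => h) y)).real
        Set.univ = (gibbs c ε γ f).real Set.univ +
      (Real.exp (h / ε) - 1) * ((gibbs c ε γ f).map fun x => x i).real A := by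
  have := hf.isFiniteMeasure_gibbs (γ := γ) hε hc0
  have hB : MeasurableSet ((fun x : ∀ i, X i => x i) ⁻¹' A) := measurable_pi_apply i hA
  have key : gibbs c ε γ (Function.update f i fun y => f i y + A.indicator (fun _ => h) y)
      Set.univ = ENNReal.ofReal (Real.exp (h / ε)) * gibbs c ε γ f ((fun x => x i) ⁻¹' A) +
        gibbs c ε γ f ((fun x => x i) ⁻¹' A)ᶜ := by
    rw [gibbs, gibbs, withDensity_apply _ MeasurableSet.univ, withDensity_apply _ hB,
      withDensity_apply _ hB.compl, setLIntegral_univ, ← lintegral_add_compl _ hB,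
      ← lintegral_const_mul' _ _ ENNReal.ofReal_ne_top]
    congr 1
    · refine setLIntegral_congr_fun hB fun x hx => ?_
      simp only [fOplus_update]
      rw [Set.indicator_of_mem (Set.mem_preimage.1 hx), ← ENNReal.ofReal_mul (Real.exp_pos _).le,
        ← Real.exp_add]
      congr 2
      ring
    · refine setLIntegral_congr_fun hB.compl fun x hx => ?_
      simp only [fOplus_update]
      rw [Set.indicator_of_notMem (by exact hx), add_zero, sub_add_cancel]
  rw [Measure.real, key, ENNReal.toReal_add (ENNReal.mul_ne_top ENNReal.ofReal_ne_top
    (measure_ne_top _ _)) (measure_ne_top _ _), ENNReal.toReal_mul,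
    ENNReal.toReal_ofReal (Real.exp_pos _).le, Measure.real, Measure.real,
    Measure.map_apply (measurable_pi_apply i) hA, ← measure_add_measure_compl hB,
    ENNReal.toReal_add (measure_ne_top _ _) (measure_ne_top _ _)]
  ring

/-- First-order optimality condition along a perturbation of one potential on a set where the
perturbed conjugate stays bounded. -/
lemma setIntegral_perturbation_nonneg (hε : 0 < ε) (hc0 : ∀ x, 0 ≤ c x)
    (hφ : ∀ i, IsEntropyFunction (φ i)) (hf : BddMeasTuple f)
    (hopt : ∀ g : ∀ i, X i → ℝ, BddMeasTuple g → dualFun c ε φ μ γ g ≤ dualFun c ε φ μ γ f)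
    (i : Fin N) {A : Set (X i)} (hA : MeasurableSet A) (h : ℝ) {C : ℝ}
    (hC : ∀ᵐ y ∂(μ i), y ∈ A → fconj (φ i) (-(f i y) - h) ≤ (C : EReal)) :
    IntegrableOn (fun y => (fconj (φ i) (-(f i y) - h)).toReal) A (μ i) ∧
    0 ≤ ∫ y in A, ((fconj (φ i) (-(f i y) - h)).toReal - (fconj (φ i) (-(f i y))).toReal) ∂(μ i)
      + ε * ((Real.exp (h / ε) - 1) * ((gibbs c ε γ f).map fun x => x i).real A) := by
  have hfin := fun j => (fconj_finite_of_dual_optimal hε hc0 hφ hf hopt j).1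
  have hint := fun j => (fconj_finite_of_dual_optimal hε hc0 hφ hf hopt j).2
  obtain ⟨M, hM⟩ := (hf i).2
  set v : X i → ℝ := fun y => f i y + A.indicator (fun _ => h) y with hv
  have hvm : Measurable v := (hf i).1.add (measurable_const.indicator hA)
  have hvb : ∀ y, |v y| ≤ M + |h| := fun y => by
    refine (abs_add_le _ _).trans (add_le_add (hM y) ?_)
    by_cases hy : y ∈ A <;> simp [hy]
  have hmem : ∀ y ∈ A, fconj (φ i) (-(v y)) = fconj (φ i) (-(f i y) - h) := fun y hy => by
    rw [hv]; simp only [Set.indicator_of_mem hy]; congr 1; ring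
  have hnot : ∀ y ∉ A, fconj (φ i) (-(v y)) = fconj (φ i) (-(f i y)) := fun y hy => by
    rw [hv]; simp only [Set.indicator_of_notMem hy, add_zero]
  set g := Function.update f i v with hg
  have hgi : g i = v := Function.update_self ..
  have hgj : ∀ j, j ≠ i → g j = f j := fun j hj => Function.update_of_ne hj ..
  have hgb : BddMeasTuple g := fun j => by
    by_cases hj : j = i
    · subst hj; rw [hgi]; exact ⟨hvm, _, hvb⟩
    · rw [hgj j hj]; exact hf j
  have hvfin : ∀ᵐ y ∂(μ i), fconj (φ i) (-(v y)) ≠ ⊤ := by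
    filter_upwards [hC, hfin i] with y h1 h2
    by_cases hy : y ∈ A
    · rw [hmem y hy]; exact ne_top_of_le_ne_top (EReal.coe_ne_top _) (h1 hy)
    · rwa [hnot y hy]
  have hmeas : Measurable fun y => (fconj (φ i) (-(f i y) - h)).toReal :=
    ((hφ i).fconj_mono.measurable.comp ((hf i).1.neg.sub_const h)).ereal_toReal
  have hA1 : IntegrableOn (fun y => (fconj (φ i) (-(f i y) - h)).toReal) A (μ i) := by
    refine Integrable.of_bound hmeas.aestronglyMeasurable (max |C| (M + |h|)) ?_
    rw [ae_restrict_iff' hA]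
    filter_upwards [hC] with y h1 hy
    have hne := ne_top_of_le_ne_top (EReal.coe_ne_top _) (h1 hy)
    have h2 := h1 hy
    rw [← (hφ i).coe_toReal_fconj hne, EReal.coe_le_coe_iff] at h2
    have h3 := (hφ i).le_toReal_fconj hne
    rw [Real.norm_eq_abs, abs_le]
    constructor
    · linarith [le_max_right |C| (M + |h|), le_abs_self (f i y), hM y, le_abs_self h]
    · exact h2.trans ((le_abs_self C).trans (le_max_left _ _))
  have hA2 : IntegrableOn (fun y => (fconj (φ i) (-(v y))).toReal) A (μ i) :=
    hA1.congr_fun (fun y hy => by simp only [hmem y hy]) hA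
  have hA3 : IntegrableOn (fun y => (fconj (φ i) (-(v y))).toReal) Aᶜ (μ i) :=
    (hint i).integrableOn.congr_fun (fun y hy => by simp only [hnot y hy]) hA.compl
  have hvint : Integrable (fun y => (fconj (φ i) (-(v y))).toReal) (μ i) := by
    rw [← integrableOn_univ, ← Set.union_compl_self A]
    exact hA2.union hA3
  have hle := hopt g hgb
  rw [dualFun_eq_coe hε hc0 hφ hf hfin hint, dualFun_eq_coe hε hc0 hφ hgb
    (fun j => by
      by_cases hj : j = i
      · subst hj; rwa [hgi]
      · rw [hgj j hj]; exact hfin j)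
    (fun j => by
      by_cases hj : j = i
      · subst hj; rwa [hgi]
      · rw [hgj j hj]; exact hint j),
    EReal.coe_le_coe_iff, hg, hv, gibbs_update_indicator_real hε hc0 hf i hA h, ← hv, ← hg,
    ← Finset.add_sum_erase _ _ (Finset.mem_univ i),
    ← Finset.add_sum_erase _ (fun j => ∫ y, (fconj (φ j) (-(f j y))).toReal ∂(μ j))
      (Finset.mem_univ i), hgi,
    Finset.sum_congr rfl (g := fun j => ∫ y, (fconj (φ j) (-(f j y))).toReal ∂(μ j))
      (fun j hj => by rw [hgj j (Finset.ne_of_mem_erase hj)]),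
    ← integral_add_compl hA hvint, ← integral_add_compl hA (hint i),
    setIntegral_congr_fun hA (g := fun y => (fconj (φ i) (-(f i y) - h)).toReal)
      (fun y hy => by simp only [hmem y hy]),
    setIntegral_congr_fun hA.compl (g := fun y => (fconj (φ i) (-(f i y))).toReal)
      (fun y hy => by simp only [hnot y hy])] at hle
  refine ⟨hA1, ?_⟩
  rw [integral_sub hA1 (hint i).integrableOn]
  linarith

/-- Marginals of the plan generated by optimal dual potentials have no singular part. -/
lemma map_gibbs_absolutelyContinuous (hε : 0 < ε) (hc0 : ∀ x, 0 ≤ c x)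
    (hφ : ∀ i, IsEntropyFunction (φ i)) (hf : BddMeasTuple f)
    (hopt : ∀ g : ∀ i, X i → ℝ, BddMeasTuple g → dualFun c ε φ μ γ g ≤ dualFun c ε φ μ γ f)
    (i : Fin N) : (gibbs c ε γ f).map (fun x => x i) ≪ μ i := by
  have := hf.isFiniteMeasure_gibbs (γ := γ) hε hc0
  refine Measure.AbsolutelyContinuous.mk fun A hA hA0 => ?_
  have h := (setIntegral_perturbation_nonneg hε hc0 hφ hf hopt i hA (-1) (C := 0)
    ((measure_eq_zero_iff_ae_notMem.1 hA0).mono fun y hy hyA => absurd hyA hy)).2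
  rw [setIntegral_measure_zero _ hA0, zero_add] at h
  have hexp : Real.exp (-1 / ε) < 1 := Real.exp_lt_one_iff.2 (div_neg_of_neg_of_pos (by simp) hε)
  have hnn : 0 ≤ ((gibbs c ε γ f).map fun x => x i).real A := measureReal_nonneg
  have h1 := nonneg_of_mul_nonneg_right h hε
  have h2 : ((gibbs c ε γ f).map fun x => x i).real A = 0 := by nlinarith
  rwa [measureReal_eq_zero_iff] at h2

/-- The marginal densities of the plan generated by optimal dual potentials attain equality in
the Fenchel–Young inequality. -/
lemma ae_entropy_rnDeriv_le (hε : 0 < ε) (hc0 : ∀ x, 0 ≤ c x)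
    (hφ : ∀ i, IsEntropyFunction (φ i)) (hf : BddMeasTuple f)
    (hopt : ∀ g : ∀ i, X i → ℝ, BddMeasTuple g → dualFun c ε φ μ γ g ≤ dualFun c ε φ μ γ f)
    (i : Fin N) : ∀ᵐ y ∂(μ i),
      φ i (((gibbs c ε γ f).map fun x => x i).rnDeriv (μ i) y).toReal ≠ ⊤ ∧
      (φ i (((gibbs c ε γ f).map fun x => x i).rnDeriv (μ i) y).toReal).toReal ≤
        -(f i y) * (((gibbs c ε γ f).map fun x => x i).rnDeriv (μ i) y).toReal -
          (fconj (φ i) (-(f i y))).toReal := by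
  have := hf.isFiniteMeasure_gibbs (γ := γ) hε hc0
  have hac := map_gibbs_absolutelyContinuous hε hc0 hφ hf hopt i
  have hfin := fconj_finite_of_dual_optimal hε hc0 hφ hf hopt i
  set p := (gibbs c ε γ f).map fun x => x i with hp
  have hall : ∀ (h : ℚ) (n : ℕ), ∀ᵐ y ∂(μ i), fconj (φ i) (-(f i y) - h) ≤ ((n : ℝ) : EReal) →
      0 ≤ ((fconj (φ i) (-(f i y) - h)).toReal - (fconj (φ i) (-(f i y))).toReal) +
        ε * (Real.exp (h / ε) - 1) * (p.rnDeriv (μ i) y).toReal := by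
    intro h n
    set A := {y | fconj (φ i) (-(f i y) - h) ≤ ((n : ℝ) : EReal)} with hAdef
    have hA : MeasurableSet A :=
      ((hφ i).fconj_mono.measurable.comp ((hf i).1.neg.sub_const (h : ℝ))) measurableSet_Iic
    have hpert : ∀ s, MeasurableSet s → s ⊆ A → _ := fun s hs hsA =>
      setIntegral_perturbation_nonneg hε hc0 hφ hf hopt i hs h (C := n)
        (Eventually.of_forall fun y hy => hsA hy)
    have hr : Integrable (fun y => ε * (Real.exp (h / ε) - 1) * (p.rnDeriv (μ i) y).toReal)
        (μ i) := Measure.integrable_toReal_rnDeriv.const_mul _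
    have hA1 : IntegrableOn (fun y => (fconj (φ i) (-(f i y) - h)).toReal -
        (fconj (φ i) (-(f i y))).toReal) A (μ i) :=
      (hpert A hA subset_rfl).1.sub hfin.2.integrableOn
    suffices 0 ≤ᵐ[(μ i).restrict A] fun y =>
        ((fconj (φ i) (-(f i y) - h)).toReal - (fconj (φ i) (-(f i y))).toReal) +
        ε * (Real.exp (h / ε) - 1) * (p.rnDeriv (μ i) y).toReal from
      (ae_restrict_iff' hA).1 this
    refine ae_nonneg_of_forall_setIntegral_nonneg (hA1.add hr.integrableOn) fun s hs _ => ?_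
    rw [Measure.restrict_restrict hs]
    have h2 := (hpert (s ∩ A) (hs.inter hA) Set.inter_subset_right).2
    rw [integral_add (hA1.mono_set Set.inter_subset_right) hr.integrableOn, integral_const_mul,
      Measure.setIntegral_toReal_rnDeriv hac]
    rw [mul_assoc]
    exact h2
  have hall' : ∀ᵐ y ∂(μ i), ∀ (h : ℚ) (n : ℕ), fconj (φ i) (-(f i y) - h) ≤ ((n : ℝ) : EReal) →
      0 ≤ ((fconj (φ i) (-(f i y) - h)).toReal - (fconj (φ i) (-(f i y))).toReal) +
        ε * (Real.exp (h / ε) - 1) * (p.rnDeriv (μ i) y).toReal :=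
    ae_all_iff.2 fun h => ae_all_iff.2 fun n => hall h n
  filter_upwards [hall', hfin.1] with y hy hyfin
  refine (hφ i).toReal_le_of_rational_minimizer hε toReal_nonneg hyfin fun h hh => ?_
  obtain ⟨n, hn⟩ := exists_nat_ge (fconj (φ i) (-(f i y) - h)).toReal
  have := hy h n (by rwa [← (hφ i).coe_toReal_fconj hh, EReal.coe_le_coe_iff])
  linarith

end Dual

section Primal

lemma klFun_eq_ofReal {x : ℝ} (hx : 0 ≤ x) :
    klFun x = ENNReal.ofReal (InformationTheory.klFun x) := by
  rw [klFun, if_neg hx.not_gt, InformationTheory.klFun_apply]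
  congr 1
  ring

lemma recession_klFun : recession klFun = ⊤ := by
  have h : Tendsto (fun x : ℝ => ENNReal.ofReal (Real.log x - 1)) atTop (𝓝 ⊤) :=
    tendsto_ofReal_nhds_top.2 (tendsto_atTop_add_const_right _ _ Real.tendsto_log_atTop)
  refine (tendsto_nhds_top_mono h ?_).limsup_eq
  filter_upwards [eventually_gt_atTop 0] with x hx
  rw [klFun, if_neg hx.le.not_gt, ← ENNReal.ofReal_div_of_pos hx]
  refine ENNReal.ofReal_le_ofReal ?_
  rw [le_div_iff₀ hx]
  linarith

section

variable {Z : Type*} [MeasurableSpace Z] {p ν : Measure Z}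

lemma Dphi_of_absolutelyContinuous (φ : ℝ → ℝ≥0∞) (h : p ≪ ν) :
    Dphi φ p ν = ∫⁻ z, φ (p.rnDeriv ν z).toReal ∂ν := by
  rw [Dphi, Measure.singularPart_eq_zero_of_ac h]
  simp

lemma KL_of_absolutelyContinuous (h : p ≪ ν) :
    KL p ν = ∫⁻ z, ENNReal.ofReal (InformationTheory.klFun (p.rnDeriv ν z).toReal) ∂ν := by
  rw [KL, Dphi_of_absolutelyContinuous _ h]
  simp only [klFun_eq_ofReal toReal_nonneg]

lemma absolutelyContinuous_of_KL_ne_top [SigmaFinite p] [SigmaFinite ν] (h : KL p ν ≠ ⊤) :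
    p ≪ ν := by
  rw [KL, Dphi, recession_klFun] at h
  have h1 := (ENNReal.add_ne_top.1 h).2
  rw [← Measure.singularPart_eq_zero, ← Measure.measure_univ_eq_zero]
  by_contra h0
  exact h1 (ENNReal.top_mul h0)

lemma measurable_klFun_rnDeriv :
    Measurable fun z => InformationTheory.klFun (p.rnDeriv ν z).toReal :=
  InformationTheory.measurable_klFun.comp (Measure.measurable_rnDeriv p ν).ennreal_toReal

lemma integrable_klFun_of_KL_ne_top (hac : p ≪ ν) (h : KL p ν ≠ ⊤) :
    Integrable (fun z => InformationTheory.klFun (p.rnDeriv ν z).toReal) ν := by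
  rw [KL_of_absolutelyContinuous hac] at h
  refine (lintegral_ofReal_ne_top_iff_integrable measurable_klFun_rnDeriv.aestronglyMeasurable
    (ae_of_all _ fun z => InformationTheory.klFun_nonneg toReal_nonneg)).1 h

end

/-- The defect in the Fenchel–Young inequality for the entropy `r ↦ r log r - r + 1`. -/
def klGap (r u : ℝ) : ℝ := InformationTheory.klFun r - u * r + (Real.exp u - 1)

lemma klGap_eq {r : ℝ} (hr : 0 ≤ r) (u : ℝ) :
    klGap r u = Real.exp u * InformationTheory.klFun (r * Real.exp (-u)) := by
  have he : Real.exp u * Real.exp (-u) = 1 := by rw [← Real.exp_add]; simp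
  rcases hr.eq_or_lt with rfl | hr
  · simp only [klGap, zero_mul, InformationTheory.klFun_zero]
    ring
  · rw [klGap, InformationTheory.klFun_apply, InformationTheory.klFun_apply,
      Real.log_mul hr.ne' (Real.exp_pos _).ne', Real.log_exp]
    linear_combination (r - r * (Real.log r - u)) * he

lemma klGap_nonneg {r : ℝ} (hr : 0 ≤ r) (u : ℝ) : 0 ≤ klGap r u := by
  rw [klGap_eq hr]
  have := InformationTheory.klFun_nonneg (mul_nonneg hr (Real.exp_pos (-u)).le)
  positivity

lemma klGap_exp (u : ℝ) : klGap (Real.exp u) u = 0 := by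
  rw [klGap, InformationTheory.klFun_apply, Real.log_exp]
  ring

lemma eq_exp_of_klGap_eq_zero {r u : ℝ} (hr : 0 ≤ r) (h : klGap r u = 0) : r = Real.exp u := by
  rw [klGap_eq hr, mul_eq_zero, or_iff_right (Real.exp_pos u).ne',
    InformationTheory.klFun_eq_zero_iff (by positivity), Real.exp_neg, ← div_eq_mul_inv,
    div_eq_one_iff_eq (Real.exp_pos u).ne'] at h
  exact h

variable {N : ℕ} {X : Fin N → Type*} [∀ i, MeasurableSpace (X i)]
  {μ γ : ∀ i, Measure (X i)} [∀ i, IsFiniteMeasure (γ i)]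
  {c : (∀ i, X i) → ℝ} {ε : ℝ} {φ : Fin N → ℝ → ℝ≥0∞} {f : ∀ i, X i → ℝ}

/-- The defect in the Fenchel–Young inequality for the `i`-th marginal penalty. -/
def marginalGap (φ : ℝ → ℝ≥0∞) (s q : ℝ) : ℝ := (φ s).toReal - q * s + (fconj φ q).toReal

lemma BddMeasTuple.measurable_exponent (hcm : Measurable c) (hf : BddMeasTuple f) :
    Measurable fun x => (fOplus f x - c x) / ε :=
  (hf.measurable_fOplus.sub hcm).div_const ε

lemma BddMeasTuple.exists_abs_exponent_le (hε : 0 < ε) (hc0 : ∀ x, 0 ≤ c x)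
    (hcb : ∃ C, ∀ x, c x ≤ C) (hf : BddMeasTuple f) :
    ∃ M, ∀ x, |(fOplus f x - c x) / ε| ≤ M := by
  obtain ⟨M, hM⟩ := hf.exists_abs_fOplus_le
  obtain ⟨C, hC⟩ := hcb
  refine ⟨(M + C) / ε, fun x => ?_⟩
  rw [abs_div, abs_of_pos hε]
  gcongr
  refine (abs_sub _ _).trans (add_le_add (hM x) ?_)
  rw [abs_of_nonneg (hc0 x)]
  exact hC x

variable [∀ i, IsFiniteMeasure (μ i)]

lemma integrable_potential_mul_rnDeriv {Z : Type*} [MeasurableSpace Z] {p ν : Measure Z}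
    [IsFiniteMeasure p] {g : Z → ℝ} (hg : Measurable g) (hb : ∃ M, ∀ z, |g z| ≤ M) :
    Integrable (fun z => g z * (p.rnDeriv ν z).toReal) ν := by
  obtain ⟨M, hM⟩ := hb
  exact Measure.integrable_toReal_rnDeriv.bdd_mul hg.aestronglyMeasurable (ae_of_all _ hM)

/-- The primal cost of a plan is the dual value plus the Fenchel–Young defects. -/
lemma primalCost_eq (hε : 0 < ε) (hcm : Measurable c) (hc0 : ∀ x, 0 ≤ c x)
    (hcb : ∃ C, ∀ x, c x ≤ C) (hf : BddMeasTuple f)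
    (hF : ∀ i, Integrable (fun y => (fconj (φ i) (-(f i y))).toReal) (μ i))
    (p : Measure (∀ i, X i)) [IsFiniteMeasure p] (hp : p ≪ Measure.pi γ)
    (hpi : ∀ i, p.map (fun x => x i) ≪ μ i)
    (hkl : Integrable (fun x => InformationTheory.klFun (p.rnDeriv (Measure.pi γ) x).toReal)
      (Measure.pi γ))
    (hφfin : ∀ i, ∀ᵐ y ∂(μ i), φ i ((p.map fun x => x i).rnDeriv (μ i) y).toReal ≠ ⊤)
    (hφint : ∀ i, Integrable
      (fun y => (φ i ((p.map fun x => x i).rnDeriv (μ i) y).toReal).toReal) (μ i)) :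
    ∃ P : ℝ, 0 ≤ P ∧ primalCost c ε φ μ γ p = ENNReal.ofReal P ∧
      P = -(∑ i, ∫ y, (fconj (φ i) (-(f i y))).toReal ∂(μ i)) -
          ε * (∫ x, (Real.exp ((fOplus f x - c x) / ε) - 1) ∂(Measure.pi γ)) +
        ε * (∫ x, klGap (p.rnDeriv (Measure.pi γ) x).toReal ((fOplus f x - c x) / ε)
          ∂(Measure.pi γ)) +
        ∑ i, ∫ y, marginalGap (φ i) ((p.map fun x => x i).rnDeriv (μ i) y).toReal (-(f i y))
          ∂(μ i) := by
  have hcint : Integrable c p := by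
    obtain ⟨C, hC⟩ := hcb
    refine Integrable.of_bound hcm.aestronglyMeasurable C (ae_of_all _ fun x => ?_)
    rw [Real.norm_of_nonneg (hc0 x)]
    exact hC x
  have hfint : ∀ i, Integrable (fun x : ∀ i, X i => f i (x i)) p := fun i => by
    obtain ⟨M, hM⟩ := (hf i).2
    exact Integrable.of_bound ((hf i).1.comp (measurable_pi_apply i)).aestronglyMeasurable M
      (ae_of_all _ fun x => hM (x i))
  have hmarg : ∀ i, ∫ y, marginalGap (φ i) ((p.map fun x => x i).rnDeriv (μ i) y).toReal
      (-(f i y)) ∂(μ i) = ∫ y, (φ i ((p.map fun x => x i).rnDeriv (μ i) y).toReal).toReal ∂(μ i)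
      + ∫ x, f i (x i) ∂p + ∫ y, (fconj (φ i) (-(f i y))).toReal ∂(μ i) := fun i => by
    have h1 := integral_toReal_rnDeriv_mul (hpi i) (f := f i)
    rw [integral_map (measurable_pi_apply i).aemeasurable (hf i).1.aestronglyMeasurable] at h1
    have h2 := integrable_potential_mul_rnDeriv (p := p.map fun x => x i) (ν := μ i)
      (hf i).1 (hf i).2
    simp only [mul_comm (f i _)] at h2
    have h3 : Integrable (fun y =>
        (φ i ((p.map fun x => x i).rnDeriv (μ i) y).toReal).toReal +
          ((p.map fun x => x i).rnDeriv (μ i) y).toReal * f i y) (μ i) := (hφint i).add h2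
    rw [← h1, ← integral_add (hφint i) h2, ← integral_add h3 (hF i)]
    refine integral_congr_ae (ae_of_all _ fun y => ?_)
    simp only [marginalGap]
    ring
  obtain ⟨M, hM⟩ := hf.exists_abs_exponent_le hε hc0 hcb
  have hum := hf.measurable_exponent (ε := ε) hcm
  have hexpint : Integrable (fun x => Real.exp ((fOplus f x - c x) / ε) - 1) (Measure.pi γ) := by
    refine (Integrable.of_bound hum.exp.aestronglyMeasurable (Real.exp M)
      (ae_of_all _ fun x => ?_)).sub (integrable_const _)
    rw [Real.norm_of_nonneg (Real.exp_pos _).le]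
    exact Real.exp_le_exp.2 ((le_abs_self _).trans (hM x))
  have hgap : ε * ∫ x, klGap (p.rnDeriv (Measure.pi γ) x).toReal ((fOplus f x - c x) / ε)
      ∂(Measure.pi γ) =
      ε * ∫ x, InformationTheory.klFun (p.rnDeriv (Measure.pi γ) x).toReal ∂(Measure.pi γ)
      - (∑ i, ∫ x, f i (x i) ∂p - ∫ x, c x ∂p) +
      ε * ∫ x, (Real.exp ((fOplus f x - c x) / ε) - 1) ∂(Measure.pi γ) := by
    have h1 := integral_toReal_rnDeriv_mul hp (f := fun x => (fOplus f x - c x) / ε)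
    have h2 : ∫ x, (fOplus f x - c x) / ε ∂p =
        (∑ i, ∫ x, f i (x i) ∂p - ∫ x, c x ∂p) / ε := by
      have hsum : Integrable (fOplus f) p := integrable_finsetSum _ fun i _ => hfint i
      rw [integral_div, integral_sub hsum hcint]
      simp only [fOplus]
      rw [integral_finsetSum _ fun i _ => hfint i]
    have h3 := integrable_potential_mul_rnDeriv (p := p) (ν := Measure.pi γ) hum ⟨M, hM⟩
    rw [h2] at h1
    simp only [klGap]
    have h4 : Integrable (fun x => InformationTheory.klFun (p.rnDeriv (Measure.pi γ) x).toReal -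
        (fOplus f x - c x) / ε * (p.rnDeriv (Measure.pi γ) x).toReal) (Measure.pi γ) :=
      hkl.sub h3
    rw [integral_add h4 hexpint, integral_sub hkl h3]
    simp only [mul_comm _ (ENNReal.toReal _)]
    rw [h1]
    field_simp
  refine ⟨∫ x, c x ∂p +
    ε * ∫ x, InformationTheory.klFun (p.rnDeriv (Measure.pi γ) x).toReal ∂(Measure.pi γ) +
    ∑ i, ∫ y, (φ i ((p.map fun x => x i).rnDeriv (μ i) y).toReal).toReal ∂(μ i), ?_, ?_, ?_⟩
  · have h1 : 0 ≤ ∫ x, c x ∂p := integral_nonneg hc0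
    have h2 : 0 ≤ ∫ x, InformationTheory.klFun (p.rnDeriv (Measure.pi γ) x).toReal
        ∂(Measure.pi γ) := integral_nonneg fun x => InformationTheory.klFun_nonneg toReal_nonneg
    have h3 : 0 ≤ ∑ i, ∫ y, (φ i ((p.map fun x => x i).rnDeriv (μ i) y).toReal).toReal ∂(μ i) :=
      Finset.sum_nonneg fun i _ => integral_nonneg fun y => toReal_nonneg
    positivity
  · have h1 : 0 ≤ ∫ x, c x ∂p := integral_nonneg hc0
    have h2 : 0 ≤ ∫ x, InformationTheory.klFun (p.rnDeriv (Measure.pi γ) x).toReal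
        ∂(Measure.pi γ) := integral_nonneg fun x => InformationTheory.klFun_nonneg toReal_nonneg
    have h3 : ∀ i, 0 ≤ ∫ y, (φ i ((p.map fun x => x i).rnDeriv (μ i) y).toReal).toReal ∂(μ i) :=
      fun i => integral_nonneg fun y => toReal_nonneg
    rw [primalCost, KL_of_absolutelyContinuous hp,
      ENNReal.ofReal_add (by positivity) (Finset.sum_nonneg fun i _ => h3 i),
      ENNReal.ofReal_add h1 (by positivity), ENNReal.ofReal_mul hε.le,
      ofReal_integral_eq_lintegral_ofReal hcint (ae_of_all _ hc0),
      ofReal_integral_eq_lintegral_ofReal hkl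
        (ae_of_all _ fun x => InformationTheory.klFun_nonneg toReal_nonneg),
      ENNReal.ofReal_sum_of_nonneg fun i _ => h3 i]
    congr 1
    refine Finset.sum_congr rfl fun i _ => ?_
    rw [Dphi_of_absolutelyContinuous _ (hpi i), ofReal_integral_eq_lintegral_ofReal (hφint i)
      (ae_of_all _ fun y => toReal_nonneg)]
    refine lintegral_congr_ae ?_
    filter_upwards [hφfin i] with y hy using (ENNReal.ofReal_toReal hy).symm
  · rw [hgap, Finset.sum_congr rfl fun i _ => hmarg i, Finset.sum_add_distrib,
      Finset.sum_add_distrib]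
    ring

/-- The plan generated by optimal dual potentials has finite primal cost, equal to the dual
value, up to marginal defects that have the favourable sign. -/
lemma primalCost_gibbs_le (hε : 0 < ε) (hcm : Measurable c) (hc0 : ∀ x, 0 ≤ c x)
    (hcb : ∃ C, ∀ x, c x ≤ C) (hφ : ∀ i, IsEntropyFunction (φ i)) (hf : BddMeasTuple f)
    (hopt : ∀ g : ∀ i, X i → ℝ, BddMeasTuple g →
      dualFun c ε φ μ γ g ≤ dualFun c ε φ μ γ f) :
    ∃ P : ℝ, 0 ≤ P ∧ primalCost c ε φ μ γ (gibbs c ε γ f) = ENNReal.ofReal P ∧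
      P ≤ -(∑ i, ∫ y, (fconj (φ i) (-(f i y))).toReal ∂(μ i)) -
          ε * (∫ x, (Real.exp ((fOplus f x - c x) / ε) - 1) ∂(Measure.pi γ)) := by
  have := hf.isFiniteMeasure_gibbs (γ := γ) hε hc0
  have hF := fun i => (fconj_finite_of_dual_optimal hε hc0 hφ hf hopt i).2
  have hum := hf.measurable_exponent (ε := ε) hcm
  obtain ⟨M, hM⟩ := hf.exists_abs_exponent_le hε hc0 hcb
  have hdens : ∀ᵐ x ∂(Measure.pi γ), ((gibbs c ε γ f).rnDeriv (Measure.pi γ) x).toReal =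
      Real.exp ((fOplus f x - c x) / ε) := by
    filter_upwards [Measure.rnDeriv_withDensity (Measure.pi γ) hum.exp.ennreal_ofReal] with x hx
    rw [gibbs, hx, ENNReal.toReal_ofReal (Real.exp_pos _).le]
  have hkl : Integrable (fun x => InformationTheory.klFun
      ((gibbs c ε γ f).rnDeriv (Measure.pi γ) x).toReal) (Measure.pi γ) := by
    refine Integrable.of_bound measurable_klFun_rnDeriv.aestronglyMeasurable
      (Real.exp M * M + 1) ?_
    filter_upwards [hdens] with x hx
    rw [hx, Real.norm_of_nonneg (InformationTheory.klFun_nonneg (Real.exp_pos _).le),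
      InformationTheory.klFun_apply, Real.log_exp]
    have h1 : Real.exp ((fOplus f x - c x) / ε) ≤ Real.exp M :=
      Real.exp_le_exp.2 ((le_abs_self _).trans (hM x))
    have h2 : Real.exp ((fOplus f x - c x) / ε) * ((fOplus f x - c x) / ε) ≤ Real.exp M * M :=
      (mul_le_mul_of_nonneg_left ((le_abs_self _).trans (hM x)) (Real.exp_pos _).le).trans
        (mul_le_mul_of_nonneg_right h1 ((abs_nonneg _).trans (hM x)))
    linarith [Real.exp_pos ((fOplus f x - c x) / ε)]
  have hyoung := fun i => ae_entropy_rnDeriv_le hε hc0 hφ hf hopt i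
  have hφint : ∀ i, Integrable (fun y =>
      (φ i (((gibbs c ε γ f).map fun x => x i).rnDeriv (μ i) y).toReal).toReal) (μ i) := by
    intro i
    have h2 := integrable_potential_mul_rnDeriv (p := (gibbs c ε γ f).map fun x => x i)
      (ν := μ i) (hf i).1 (hf i).2
    refine Integrable.mono' (h2.neg.sub (hF i)) ((hφ i).lsc.measurable.comp
      (Measure.measurable_rnDeriv _ _).ennreal_toReal).ennreal_toReal.aestronglyMeasurable ?_
    filter_upwards [hyoung i] with y hy
    rw [Real.norm_of_nonneg toReal_nonneg]
    refine hy.2.trans_eq ?_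
    simp
  obtain ⟨P, hP0, hP, hPeq⟩ := primalCost_eq hε hcm hc0 hcb hf hF (gibbs c ε γ f)
    (withDensity_absolutelyContinuous _ _)
    (fun i => map_gibbs_absolutelyContinuous hε hc0 hφ hf hopt i) hkl
    (fun i => (hyoung i).mono fun y hy => hy.1) hφint
  refine ⟨P, hP0, hP, ?_⟩
  have hgap : ∫ x, klGap ((gibbs c ε γ f).rnDeriv (Measure.pi γ) x).toReal
      ((fOplus f x - c x) / ε) ∂(Measure.pi γ) = 0 := by
    refine integral_eq_zero_of_ae ?_
    filter_upwards [hdens] with x hx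
    rw [hx, klGap_exp, Pi.zero_apply]
  have hmarg : ∑ i, ∫ y, marginalGap (φ i)
      (((gibbs c ε γ f).map fun x => x i).rnDeriv (μ i) y).toReal (-(f i y)) ∂(μ i) ≤ 0 := by
    refine Finset.sum_nonpos fun i _ => integral_nonpos_of_ae ?_
    filter_upwards [hyoung i] with y hy
    simp only [marginalGap, Pi.zero_apply]
    linarith [hy.2]
  rw [hgap] at hPeq
  linarith

/-- A plan whose primal cost is at most the dual value is generated by the dual potentials. -/
lemma eq_gibbs_of_primalCost_le (hε : 0 < ε) (hcm : Measurable c) (hc0 : ∀ x, 0 ≤ c x)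
    (hcb : ∃ C, ∀ x, c x ≤ C) (hφ : ∀ i, IsEntropyFunction (φ i)) (hf : BddMeasTuple f)
    (hopt : ∀ g : ∀ i, X i → ℝ, BddMeasTuple g →
      dualFun c ε φ μ γ g ≤ dualFun c ε φ μ γ f)
    (p : Measure (∀ i, X i)) [IsFiniteMeasure p]
    (hple : primalCost c ε φ μ γ p ≤ primalCost c ε φ μ γ (gibbs c ε γ f)) :
    p = gibbs c ε γ f := by
  have hfin := fun i => fconj_finite_of_dual_optimal hε hc0 hφ hf hopt i
  have hum := hf.measurable_exponent (ε := ε) hcm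
  obtain ⟨Q, hQ0, hQ, hQle⟩ := primalCost_gibbs_le hε hcm hc0 hcb hφ hf hopt
  rw [hQ] at hple
  have hpfin := ne_top_of_le_ne_top ofReal_ne_top hple
  rw [primalCost, ENNReal.add_ne_top, ENNReal.add_ne_top] at hpfin
  obtain ⟨⟨-, hKL⟩, hsum⟩ := hpfin
  have hKL' : KL p (Measure.pi γ) ≠ ⊤ := fun htop => hKL (by
    rw [htop, ENNReal.mul_top (by simpa using hε)])
  have hac := absolutelyContinuous_of_KL_ne_top hKL'
  have hpi : ∀ i, p.map (fun x => x i) ≪ μ i := fun i =>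
    ((hac.trans (withDensity_absolutelyContinuous' hum.exp.ennreal_ofReal.aemeasurable
      (ae_of_all _ fun x => by simp [Real.exp_pos]))).map (measurable_pi_apply i)).trans
      (map_gibbs_absolutelyContinuous hε hc0 hφ hf hopt i)
  have hφm : ∀ i, Measurable fun y => φ i ((p.map fun x => x i).rnDeriv (μ i) y).toReal :=
    fun i => (hφ i).lsc.measurable.comp (Measure.measurable_rnDeriv _ _).ennreal_toReal
  have hD : ∀ i, ∫⁻ y, φ i ((p.map fun x => x i).rnDeriv (μ i) y).toReal ∂(μ i) ≠ ⊤ := fun i => by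
    rw [← Dphi_of_absolutelyContinuous _ (hpi i)]
    exact ENNReal.sum_ne_top.1 hsum i (Finset.mem_univ i)
  have hφfin : ∀ i, ∀ᵐ y ∂(μ i), φ i ((p.map fun x => x i).rnDeriv (μ i) y).toReal ≠ ⊤ :=
    fun i => (ae_lt_top (hφm i) (hD i)).mono fun y hy => hy.ne
  have hkl := integrable_klFun_of_KL_ne_top hac hKL'
  obtain ⟨P, hP0, hP, hPeq⟩ := primalCost_eq hε hcm hc0 hcb hf (fun i => (hfin i).2) p hac hpi
    hkl hφfin fun i => integrable_toReal_of_lintegral_ne_top (hφm i).aemeasurable (hD i)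
  rw [hP, ENNReal.ofReal_le_ofReal_iff hQ0] at hple
  have hmarg : 0 ≤ ∑ i, ∫ y, marginalGap (φ i)
      ((p.map fun x => x i).rnDeriv (μ i) y).toReal (-(f i y)) ∂(μ i) := by
    refine Finset.sum_nonneg fun i _ => integral_nonneg_of_ae ?_
    filter_upwards [hφfin i, (hfin i).1] with y h1 h2
    have := (hφ i).young h2 h1
    simp only [marginalGap, Pi.zero_apply]
    linarith
  have hgapnn : ∀ x, 0 ≤ klGap (p.rnDeriv (Measure.pi γ) x).toReal ((fOplus f x - c x) / ε) :=
    fun x => klGap_nonneg toReal_nonneg _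
  have hgap0 : ∫ x, klGap (p.rnDeriv (Measure.pi γ) x).toReal ((fOplus f x - c x) / ε)
      ∂(Measure.pi γ) = 0 := by
    refine le_antisymm ?_ (integral_nonneg hgapnn)
    by_contra! h
    have := mul_pos hε h
    linarith
  obtain ⟨M, hM⟩ := hf.exists_abs_exponent_le hε hc0 hcb
  have hgapint : Integrable (fun x => klGap (p.rnDeriv (Measure.pi γ) x).toReal
      ((fOplus f x - c x) / ε)) (Measure.pi γ) := by
    refine (hkl.sub (integrable_potential_mul_rnDeriv hum ⟨M, hM⟩)).add
      ((Integrable.of_bound hum.exp.aestronglyMeasurable (Real.exp M)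
      (ae_of_all _ fun x => ?_)).sub (integrable_const _))
    rw [Real.norm_of_nonneg (Real.exp_pos _).le]
    exact Real.exp_le_exp.2 ((le_abs_self _).trans (hM x))
  rw [integral_eq_zero_iff_of_nonneg hgapnn hgapint] at hgap0
  rw [← Measure.withDensity_rnDeriv_eq p _ hac, gibbs]
  refine withDensity_congr_ae ?_
  filter_upwards [hgap0, Measure.rnDeriv_ne_top p (Measure.pi γ)] with x hx hxtop
  rw [← eq_exp_of_klGap_eq_zero toReal_nonneg hx, ENNReal.ofReal_toReal hxtop]

end Primal

/-- Proposition 3.2, primal-dual relation: any optimal plan `π̂` of the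
primal problem and any optimal tuple of dual potentials `f̂` are related by
`π̂ = exp((f̂^⊕ − c)/ε) γ^⊗`. -/
theorem UMOT_primal_dual_relation
    {N : ℕ} {X : Fin N → Type*}
    [∀ i, TopologicalSpace (X i)] [∀ i, PolishSpace (X i)] [∀ i, CompactSpace (X i)]
    [∀ i, Nonempty (X i)] [∀ i, MeasurableSpace (X i)] [∀ i, BorelSpace (X i)]
    (μ γ : ∀ i, Measure (X i)) [∀ i, IsFiniteMeasure (μ i)] [∀ i, IsFiniteMeasure (γ i)]
    (hsupp : ∀ i (U : Set (X i)), IsOpen U → U.Nonempty → 0 < μ i U)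
    (hKL : KL (Measure.pi μ) (Measure.pi γ) < ⊤)
    (c : (∀ i, X i) → ℝ) (hc : Continuous c) (hc0 : ∀ x, 0 ≤ c x)
    (ε : ℝ) (hε : 0 < ε)
    (φ : Fin N → ℝ → ℝ≥0∞) (hφ : ∀ i, IsEntropyFunction (φ i))
    -- π̂ is an optimal transport plan of the primal problem
    (plhat : Measure (∀ i, X i)) [IsFiniteMeasure plhat]
    (hplopt : primalCost c ε φ μ γ plhat = UMOTval c ε φ μ γ)
    -- f̂ is a tuple of optimal dual potentials
    (fhat : ∀ i, X i → ℝ) (hfbm : BddMeasTuple fhat)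
    (hfopt : ∀ g : ∀ i, X i → ℝ, BddMeasTuple g →
      dualFun c ε φ μ γ g ≤ dualFun c ε φ μ γ fhat) :
    plhat = (Measure.pi γ).withDensity
      (fun x => ENNReal.ofReal (Real.exp ((fOplus fhat x - c x) / ε))) := by
  have hcb : ∃ C, ∀ x, c x ≤ C := by
    obtain ⟨C, hC⟩ := (isCompact_range hc).bddAbove
    exact ⟨C, fun x => hC ⟨x, rfl⟩⟩
  have := hfbm.isFiniteMeasure_gibbs (γ := γ) hε hc0
  refine eq_gibbs_of_primalCost_le hε hc.measurable hc0 hcb hφ hfbm hfopt plhat ?_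
  rw [hplopt]
  exact iInf₂_le (gibbs c ε γ fhat) this

end UMOT
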